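/- Let (A, ∘, Δ, N, S) be a Nijenhuis pre-Lie bialgebra over a field K. Define [x, y] := x∘y − y∘x and δ(x) := x₍₁₎⊗x₍₂₎ − x₍₂₎⊗x₍₁₎ (with Δ(x) = x₍₁₎⊗x₍₂₎). Then (A, [·,·], δ, N, S) is a Nijenhuis Lie bialgebra if and only if (A, ∘, Δ) is balanced. -/

import Mathlib

open TensorProduct LinearMap

noncomputable section

section Defs

variable (K A : Type*) [Field K] [AddCommGroup A] [Module K A]

/-- The flip map on `A ⊗ A`. -/
def flipT : A ⊗[K] A →ₗ[K] A ⊗[K] A := (TensorProduct.comm K A A).toLinearMap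

/-- Swap the first two tensor factors of `A ⊗ (A ⊗ A)`. -/
def swap12 : A ⊗[K] (A ⊗[K] A) →ₗ[K] A ⊗[K] (A ⊗[K] A) :=
  (TensorProduct.assoc K A A A).toLinearMap ∘ₗ
    (TensorProduct.map (flipT K A) LinearMap.id) ∘ₗ
      (TensorProduct.assoc K A A A).symm.toLinearMap

/-- Cyclic permutation `a ⊗ b ⊗ c ↦ c ⊗ a ⊗ b` on `A ⊗ (A ⊗ A)`. -/
def cyc : A ⊗[K] (A ⊗[K] A) →ₗ[K] A ⊗[K] (A ⊗[K] A) :=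
  (TensorProduct.comm K (A ⊗[K] A) A).toLinearMap ∘ₗ
    (TensorProduct.assoc K A A A).symm.toLinearMap

variable {K A}

/-- `coassoc1 Δ δ x = x₍₁₎₍₁'₎ ⊗ x₍₁₎₍₂'₎ ⊗ x₍₂₎`, applying `δ` to the first Sweedler leg of `Δ`. -/
def coassoc1 (Δ δ : A →ₗ[K] A ⊗[K] A) : A →ₗ[K] A ⊗[K] (A ⊗[K] A) :=
  (TensorProduct.assoc K A A A).toLinearMap ∘ₗ (TensorProduct.map δ LinearMap.id) ∘ₗ Δ

/-- `coassoc2 Δ δ x = x₍₁₎ ⊗ x₍₂₎₍₁'₎ ⊗ x₍₂₎₍₂'₎`, applying `δ` to the second Sweedler leg of `Δ`. -/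
def coassoc2 (Δ δ : A →ₗ[K] A ⊗[K] A) : A →ₗ[K] A ⊗[K] (A ⊗[K] A) :=
  (TensorProduct.map LinearMap.id δ) ∘ₗ Δ

/-- The (left) pre-Lie identity for a bilinear multiplication. -/
def IsPreLie (m : A →ₗ[K] A →ₗ[K] A) : Prop :=
  ∀ x y z : A, m (m x y) z - m x (m y z) = m (m y x) z - m y (m x z)

/-- The pre-Lie coalgebra identity for a comultiplication. -/
def IsPreLieCo (Δ : A →ₗ[K] A ⊗[K] A) : Prop :=
  ∀ x : A, coassoc1 Δ Δ x - coassoc2 Δ Δ x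
    = swap12 K A (coassoc1 Δ Δ x) - swap12 K A (coassoc2 Δ Δ x)

/-- Equation (2.2) of a pre-Lie bialgebra. -/
def BialgEq1 (m : A →ₗ[K] A →ₗ[K] A) (Δ : A →ₗ[K] A ⊗[K] A) : Prop :=
  ∀ x y : A, Δ (m x y) - Δ (m y x)
    = rTensor A (m x) (Δ y) + lTensor A (m x) (Δ y) - lTensor A (m.flip x) (Δ y)
      - rTensor A (m y) (Δ x) - lTensor A (m y) (Δ x) + lTensor A (m.flip y) (Δ x)

/-- Equation (2.3) of a pre-Lie bialgebra. -/
def BialgEq2 (m : A →ₗ[K] A →ₗ[K] A) (Δ : A →ₗ[K] A ⊗[K] A) : Prop :=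
  ∀ x y : A, Δ (m x y) - flipT K A (Δ (m x y))
    = lTensor A (m.flip y) (Δ x) + lTensor A (m x) (Δ y)
      - flipT K A (rTensor A (m x) (Δ y)) - flipT K A (lTensor A (m.flip y) (Δ x))
      - flipT K A (lTensor A (m x) (Δ y)) + rTensor A (m x) (Δ y)

/-- `(A, m, Δ)` is a pre-Lie bialgebra. -/
def IsPreLieBialg (m : A →ₗ[K] A →ₗ[K] A) (Δ : A →ₗ[K] A ⊗[K] A) : Prop :=
  IsPreLie m ∧ IsPreLieCo Δ ∧ BialgEq1 m Δ ∧ BialgEq2 m Δ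

/-- The linear form on `A ⊗ A` given by `u ⊗ v ↦ f u * g v`. -/
def pairForm (f g : A →ₗ[K] K) : A ⊗[K] A →ₗ[K] K :=
  TensorProduct.lift ((LinearMap.mul K K).compl₁₂ f g)

/-- The co-S-equation for a bilinear form `ω` on a pre-Lie coalgebra `(A, Δ)`. -/
def IsCoSEq (Δ : A →ₗ[K] A ⊗[K] A) (ω : A →ₗ[K] A →ₗ[K] K) : Prop :=
  ∀ x y z : A,
    pairForm (ω x) (ω.flip z) (Δ y) + pairForm (ω x) (ω y) (Δ z)
      = pairForm (ω.flip y) (ω.flip z) (Δ x) + pairForm (ω y) (ω x) (Δ z)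

/-- The multiplication `x ∘_ω y = x₍₁₎ ω(x₍₂₎, y) + y₍₁₎ ω(x, y₍₂₎) − ω(x, y₍₁₎) y₍₂₎`. -/
def omul (Δ : A →ₗ[K] A ⊗[K] A) (ω : A →ₗ[K] A →ₗ[K] K) : A →ₗ[K] A →ₗ[K] A :=
  TensorProduct.lift ((LinearMap.smulRightₗ ∘ₗ ω).flip) ∘ₗ Δ
  + (TensorProduct.lift ((LinearMap.smulRightₗ ∘ₗ ω.flip).flip) ∘ₗ Δ).flip
  - (TensorProduct.lift (LinearMap.smulRightₗ ∘ₗ ω.flip) ∘ₗ Δ).flip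

/-- `N` is a Nijenhuis operator on the (pre-)Lie algebra `(A, m)`. -/
def IsNijenhuis (m : A →ₗ[K] A →ₗ[K] A) (N : A →ₗ[K] A) : Prop :=
  ∀ x y : A, m (N x) (N y) + N (N (m x y)) = N (m (N x) y) + N (m x (N y))

/-- `S` is a Nijenhuis operator on the (pre-)Lie coalgebra `(A, Δ)`. -/
def IsNijenhuisCo (Δ : A →ₗ[K] A ⊗[K] A) (S : A →ₗ[K] A) : Prop :=
  ∀ x : A, TensorProduct.map S S (Δ x) + Δ (S (S x))
    = rTensor A S (Δ (S x)) + lTensor A S (Δ (S x))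

/-- The 2-cocycle (pseudo-Hessian) condition for a bilinear form on a pre-Lie algebra. -/
def IsHessian (m : A →ₗ[K] A →ₗ[K] A) (ω : A →ₗ[K] A →ₗ[K] K) : Prop :=
  ∀ x y z : A, ω (m x y) z - ω x (m y z) = ω (m y x) z - ω y (m x z)

/-- The multiplication `A ⊗ A →ₗ A` induced by a bilinear multiplication. -/
def mhat (m : A →ₗ[K] A →ₗ[K] A) : A ⊗[K] A →ₗ[K] A := TensorProduct.lift m

variable (K A) in
/-- The middle-four exchange `(a ⊗ b) ⊗ (c ⊗ d) ↦ (a ⊗ c) ⊗ (b ⊗ d)` as a linear map. -/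
def ttc : (A ⊗[K] A) ⊗[K] (A ⊗[K] A) →ₗ[K] (A ⊗[K] A) ⊗[K] (A ⊗[K] A) :=
  (TensorProduct.tensorTensorTensorComm K A A A A).toLinearMap

/-- `(aᵢ ⊗ bᵢ) ⊗ (aⱼ ⊗ bⱼ) ↦ aᵢ ⊗ (bᵢ∘aⱼ) ⊗ bⱼ`. -/
def sTerm1 (m : A →ₗ[K] A →ₗ[K] A) :
    (A ⊗[K] A) ⊗[K] (A ⊗[K] A) →ₗ[K] A ⊗[K] (A ⊗[K] A) :=
  lTensor A (rTensor A (mhat m)) ∘ₗ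
    lTensor A (TensorProduct.assoc K A A A).symm.toLinearMap ∘ₗ
      (TensorProduct.assoc K A A (A ⊗[K] A)).toLinearMap

/-- `(aᵢ ⊗ bᵢ) ⊗ (aⱼ ⊗ bⱼ) ↦ aᵢ ⊗ aⱼ ⊗ (bᵢ∘bⱼ)`. -/
def sTerm2 (m : A →ₗ[K] A →ₗ[K] A) :
    (A ⊗[K] A) ⊗[K] (A ⊗[K] A) →ₗ[K] A ⊗[K] (A ⊗[K] A) :=
  lTensor A (lTensor A (mhat m) ∘ₗ swap12 K A) ∘ₗ
    (TensorProduct.assoc K A A (A ⊗[K] A)).toLinearMap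

/-- `(aᵢ ⊗ bᵢ) ⊗ (aⱼ ⊗ bⱼ) ↦ (aᵢ∘aⱼ) ⊗ bᵢ ⊗ bⱼ`. -/
def sTerm3 (m : A →ₗ[K] A →ₗ[K] A) :
    (A ⊗[K] A) ⊗[K] (A ⊗[K] A) →ₗ[K] A ⊗[K] (A ⊗[K] A) :=
  rTensor (A ⊗[K] A) (mhat m) ∘ₗ ttc K A

/-- `(aᵢ ⊗ bᵢ) ⊗ (aⱼ ⊗ bⱼ) ↦ aᵢ ⊗ aⱼ ⊗ (bⱼ∘bᵢ)`. -/
def sTerm4 (m : A →ₗ[K] A →ₗ[K] A) :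
    (A ⊗[K] A) ⊗[K] (A ⊗[K] A) →ₗ[K] A ⊗[K] (A ⊗[K] A) :=
  lTensor A (lTensor A (mhat m ∘ₗ flipT K A)) ∘ₗ
    (TensorProduct.assoc K A A (A ⊗[K] A)).toLinearMap ∘ₗ ttc K A

/-- `r` is a solution of the S-equation in the pre-Lie algebra `(A, m)`. -/
def IsSEq (m : A →ₗ[K] A →ₗ[K] A) (r : A ⊗[K] A) : Prop :=
  sTerm1 m (r ⊗ₜ[K] r) + sTerm2 m (r ⊗ₜ[K] r)
    = sTerm3 m (r ⊗ₜ[K] r) + sTerm4 m (r ⊗ₜ[K] r)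

/-- The comultiplication `Δ_r(x) = x∘aᵢ ⊗ bᵢ + aᵢ ⊗ x∘bᵢ − aᵢ ⊗ bᵢ∘x`. -/
def coprodR (m : A →ₗ[K] A →ₗ[K] A) (r : A ⊗[K] A) : A →ₗ[K] A ⊗[K] A :=
  (rTensorHom (M := A) ∘ₗ m).flip r + (lTensorHom (M := A) ∘ₗ m).flip r
    - (lTensorHom (M := A) ∘ₗ m.flip).flip r

/-- The Nijenhuis pre-Lie algebra `((A, m), N)` is `S`-admissible. -/
def IsAdmissible (m : A →ₗ[K] A →ₗ[K] A) (N S : A →ₗ[K] A) : Prop :=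
  (∀ x y : A, S (m (N x) y) + m x (S (S y)) = m (N x) (S y) + S (m x (S y))) ∧
  (∀ x y : A, S (m x (N y)) + m (S (S x)) y = m (S x) (N y) + S (m (S x) y))

/-- `((A*, Δ*), S*)` is `N*`-admissible, written on `A`. -/
def IsCoAdmissible (Δ : A →ₗ[K] A ⊗[K] A) (N S : A →ₗ[K] A) : Prop :=
  (∀ x : A, lTensor A S (Δ (N x)) + rTensor A (N ∘ₗ N) (Δ x)
      = TensorProduct.map N S (Δ x) + rTensor A N (Δ (N x))) ∧
  (∀ x : A, rTensor A S (Δ (N x)) + lTensor A (N ∘ₗ N) (Δ x)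
      = TensorProduct.map S N (Δ x) + lTensor A N (Δ (N x)))

/-- `(A, m, Δ, N, S)` is a Nijenhuis pre-Lie bialgebra. -/
def IsNijPreLieBialg (m : A →ₗ[K] A →ₗ[K] A) (Δ : A →ₗ[K] A ⊗[K] A)
    (N S : A →ₗ[K] A) : Prop :=
  IsPreLie m ∧ IsNijenhuis m N ∧ IsPreLieCo Δ ∧ IsNijenhuisCo Δ S ∧
    BialgEq1 m Δ ∧ BialgEq2 m Δ ∧ IsAdmissible m N S ∧ IsCoAdmissible Δ N S

/-- The pre-Lie bialgebra `(A, m, Δ)` is balanced. -/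
def IsBalanced (m : A →ₗ[K] A →ₗ[K] A) (Δ : A →ₗ[K] A ⊗[K] A) : Prop :=
  ∀ x y : A, rTensor A (m.flip y) (Δ x) + flipT K A (rTensor A (m.flip x) (Δ y))
    = rTensor A (m.flip x) (Δ y) + flipT K A (rTensor A (m.flip y) (Δ x))

/-- `(A, b)` is a Lie algebra. -/
def IsLieBracket (b : A →ₗ[K] A →ₗ[K] A) : Prop :=
  (∀ x : A, b x x = 0) ∧
  (∀ x y z : A, b (b x y) z + b (b y z) x + b (b z x) y = 0)

/-- `(A, d)` is a Lie coalgebra. -/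
def IsLieCobracket (d : A →ₗ[K] A ⊗[K] A) : Prop :=
  (∀ x : A, d x = - flipT K A (d x)) ∧
  (∀ x : A, coassoc2 d d x + cyc K A (coassoc2 d d x) + cyc K A (cyc K A (coassoc2 d d x)) = 0)

/-- `(A, b, d)` is a Lie bialgebra. -/
def IsLieBialg (b : A →ₗ[K] A →ₗ[K] A) (d : A →ₗ[K] A ⊗[K] A) : Prop :=
  IsLieBracket b ∧ IsLieCobracket d ∧
    ∀ x y : A, d (b x y)
      = rTensor A (b x) (d y) + lTensor A (b x) (d y)
        - rTensor A (b y) (d x) - lTensor A (b y) (d x)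

/-- `(A, b, d, N, S)` is a Nijenhuis Lie bialgebra. -/
def IsNijLieBialg (b : A →ₗ[K] A →ₗ[K] A) (d : A →ₗ[K] A ⊗[K] A)
    (N S : A →ₗ[K] A) : Prop :=
  IsLieBialg b d ∧ IsNijenhuis b N ∧ IsNijenhuisCo d S ∧
  (∀ x y : A, S (b (N x) y) + b x (S (S y)) = b (N x) (S y) + S (b x (S y))) ∧
  (∀ x : A, rTensor A S (d (N x)) + lTensor A (N ∘ₗ N) (d x)
      = TensorProduct.map S N (d x) + lTensor A N (d (N x)))

/-- The map `r♯ : A* → A`, `r♯(f) = Σ f(aᵢ) bᵢ`. -/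
def rsharp (r : A ⊗[K] A) (f : A →ₗ[K] K) : A :=
  TensorProduct.lift (LinearMap.lsmul K A ∘ₗ f) r

/-- The map `N : A → A`, `N(x) = Σ ω(x, aᵢ) bᵢ`. -/
def hessNij (ω : A →ₗ[K] A →ₗ[K] K) (r : A ⊗[K] A) : A →ₗ[K] A :=
  TensorProduct.lift (LinearMap.smulRightₗ ∘ₗ ω.flip) r

/-- The map `S : A → A`, `S(x) = Σ aᵢ ω(bᵢ, x)`. -/
def coNij (ω : A →ₗ[K] A →ₗ[K] K) (r : A ⊗[K] A) : A →ₗ[K] A :=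
  TensorProduct.lift ((LinearMap.smulRightₗ ∘ₗ ω).flip) r

end Defs

section Rep

variable {K A V H : Type*} [Field K] [AddCommGroup A] [Module K A]
  [AddCommGroup V] [Module K V] [AddCommGroup H] [Module K H]

/-- `(V, ρ, φ)` is a representation of the pre-Lie algebra `(A, m)`. -/
def IsRep (m : A →ₗ[K] A →ₗ[K] A) (ρ φ : A →ₗ[K] V →ₗ[K] V) : Prop :=
  (∀ (x y : A) (v : V), ρ (m x y - m y x) v = ρ x (ρ y v) - ρ y (ρ x v)) ∧
  (∀ (x y : A) (v : V), φ (m x y) v = ρ x (φ y v) - φ y (ρ x v) + φ y (φ x v))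

/-- The `α`-conditions making `((V, ρ, φ), α)` a representation of `((A, m), N)`. -/
def IsNijRep (m : A →ₗ[K] A →ₗ[K] A) (N : A →ₗ[K] A) (ρ φ : A →ₗ[K] V →ₗ[K] V)
    (α : V →ₗ[K] V) : Prop :=
  (∀ (x : A) (v : V), ρ (N x) (α v) + α (α (ρ x v)) = α (ρ (N x) v) + α (ρ x (α v))) ∧
  (∀ (x : A) (v : V), φ (N x) (α v) + α (α (φ x v)) = α (φ (N x) v) + α (φ x (α v)))

/-- The semidirect product multiplication on `A ⊕ V`:
`(x+u) ∘ (y+v) = x∘y + ρ(x)v + φ(y)u`. -/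
def semidirectMul (m : A →ₗ[K] A →ₗ[K] A) (ρ φ : A →ₗ[K] V →ₗ[K] V) :
    (A × V) →ₗ[K] (A × V) →ₗ[K] (A × V) :=
  (m.compl₁₂ (fst K A V) (fst K A V)).compr₂ (inl K A V)
  + (ρ.compl₁₂ (fst K A V) (snd K A V)).compr₂ (inr K A V)
  + ((φ.compl₁₂ (fst K A V) (snd K A V)).compr₂ (inr K A V)).flip

/-- The bicrossed product multiplication on `A ⊕ H`:
`(x+a) ∘ (y+b) = x∘y + ρ_H(a)y + φ_H(b)x + a∘b + ρ_A(x)b + φ_A(y)a`. -/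
def matchedMul (mA : A →ₗ[K] A →ₗ[K] A) (mH : H →ₗ[K] H →ₗ[K] H)
    (ρA φA : A →ₗ[K] H →ₗ[K] H) (ρH φH : H →ₗ[K] A →ₗ[K] A) :
    (A × H) →ₗ[K] (A × H) →ₗ[K] (A × H) :=
  (mA.compl₁₂ (fst K A H) (fst K A H)).compr₂ (inl K A H)
  + (ρH.compl₁₂ (snd K A H) (fst K A H)).compr₂ (inl K A H)
  + ((φH.compl₁₂ (snd K A H) (fst K A H)).compr₂ (inl K A H)).flip
  + (mH.compl₁₂ (snd K A H) (snd K A H)).compr₂ (inr K A H)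
  + (ρA.compl₁₂ (fst K A H) (snd K A H)).compr₂ (inr K A H)
  + ((φA.compl₁₂ (fst K A H) (snd K A H)).compr₂ (inr K A H)).flip

/-- Equations (3.5)–(3.8) of a matched pair of pre-Lie algebras. -/
def MatchedPairEqs (mA : A →ₗ[K] A →ₗ[K] A) (mH : H →ₗ[K] H →ₗ[K] H)
    (ρA φA : A →ₗ[K] H →ₗ[K] H) (ρH φH : H →ₗ[K] A →ₗ[K] A) : Prop :=
  (∀ (x : A) (a b : H), ρA x (mH a b)
      = -(ρA (ρH a x - φH a x) b) + mH (ρA x a - φA x a) b + φA (φH b x) a + mH a (ρA x b)) ∧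
  (∀ (x : A) (a b : H), φA x (mH a b - mH b a)
      = φA (ρH b x) a - φA (ρH a x) b + mH a (φA x b) - mH b (φA x a)) ∧
  (∀ (a : H) (x y : A), ρH a (mA x y)
      = -(ρH (ρA x a - φA x a) y) + mA (ρH a x - φH a x) y + φH (φA y a) x + mA x (ρH a y)) ∧
  (∀ (a : H) (x y : A), φH a (mA x y - mA y x)
      = φH (ρA y a) x - φH (ρA x a) y + mA x (φH a y) - mA y (φH a x))

/-- The (negative) dual action `x ↦ ρ*(x)`, `⟨ρ*(x)v*, v⟩ = −⟨v*, ρ(x)v⟩`. -/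
def negTranspose (ρ : A →ₗ[K] V →ₗ[K] V) :
    A →ₗ[K] (V →ₗ[K] K) →ₗ[K] (V →ₗ[K] K) :=
  Module.Dual.transpose (R := K) ∘ₗ (-ρ)

end Rep

set_option synthInstance.maxHeartbeats 1000000
set_option maxHeartbeats 1000000

section Helpers

variable {K A : Type*} [Field K] [AddCommGroup A] [Module K A]

theorem flipT_flipT (t : A ⊗[K] A) : flipT K A (flipT K A t) = t := by
  simp [flipT]

theorem flipT_rTensor (f : A →ₗ[K] A) (t : A ⊗[K] A) :
    flipT K A (rTensor A f t) = lTensor A f (flipT K A t) := by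
  induction t with
  | zero => simp
  | tmul a b => simp [flipT]
  | add a b ha hb => simp only [map_add, ha, hb]

theorem flipT_lTensor (f : A →ₗ[K] A) (t : A ⊗[K] A) :
    flipT K A (lTensor A f t) = rTensor A f (flipT K A t) := by
  induction t with
  | zero => simp
  | tmul a b => simp [flipT]
  | add a b ha hb => simp only [map_add, ha, hb]

theorem flipT_map (f g : A →ₗ[K] A) (t : A ⊗[K] A) :
    flipT K A (TensorProduct.map f g t) = TensorProduct.map g f (flipT K A t) := by
  induction t with
  | zero => simp
  | tmul a b => simp [flipT]
  | add a b ha hb => simp only [map_add, ha, hb]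

theorem cyc_cyc_cyc (t : A ⊗[K] (A ⊗[K] A)) : cyc K A (cyc K A (cyc K A t)) = t := by
  induction t with
  | zero => simp
  | tmul a b =>
    induction b with
    | zero => simp
    | tmul b c => simp [cyc]
    | add a b ha hb => simp only [TensorProduct.tmul_add, map_add, ha, hb]
  | add a b ha hb => simp only [map_add, ha, hb]

theorem lTensor_flipT_eq (t : A ⊗[K] (A ⊗[K] A)) :
    lTensor A (flipT K A) t = cyc K A (cyc K A (swap12 K A t)) := by
  induction t with
  | zero => simp
  | tmul a b =>
    induction b with
    | zero => simp
    | tmul b c => simp [cyc, swap12, flipT]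
    | add a b ha hb => simp only [TensorProduct.tmul_add, map_add, ha, hb]
  | add a b ha hb => simp only [map_add, ha, hb]

theorem map_id_flipT (d : A →ₗ[K] A ⊗[K] A) (t : A ⊗[K] A) :
    TensorProduct.map LinearMap.id d (flipT K A t)
      = cyc K A (TensorProduct.assoc K A A A (TensorProduct.map d LinearMap.id t)) := by
  induction t with
  | zero => simp
  | tmul a b => simp [cyc, flipT]
  | add a b ha hb => simp only [map_add, ha, hb]

theorem assoc_map_sub (d : A →ₗ[K] A ⊗[K] A) (t : A ⊗[K] A) :
    TensorProduct.assoc K A A A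
      (TensorProduct.map (d - flipT K A ∘ₗ d) LinearMap.id t)
      = TensorProduct.assoc K A A A (TensorProduct.map d LinearMap.id t)
        - swap12 K A (TensorProduct.assoc K A A A (TensorProduct.map d LinearMap.id t)) := by
  induction t with
  | zero => simp
  | tmul a b => simp [swap12, TensorProduct.sub_tmul]
  | add a b ha hb => simp only [map_add, ha, hb]; abel

theorem map_sub_id (d : A →ₗ[K] A ⊗[K] A) (t : A ⊗[K] A) :
    TensorProduct.map LinearMap.id (d - flipT K A ∘ₗ d) t
      = TensorProduct.map LinearMap.id d t
        - lTensor A (flipT K A) (TensorProduct.map LinearMap.id d t) := by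
  induction t with
  | zero => simp
  | tmul a b => simp [TensorProduct.tmul_sub]
  | add a b ha hb => simp only [map_add, ha, hb]; abel

theorem coassoc2_comm (Δ : A →ₗ[K] A ⊗[K] A) (x : A) :
    coassoc2 (Δ - flipT K A ∘ₗ Δ) (Δ - flipT K A ∘ₗ Δ) x
      = coassoc2 Δ Δ x - cyc K A (cyc K A (swap12 K A (coassoc2 Δ Δ x)))
        - cyc K A (coassoc1 Δ Δ x - swap12 K A (coassoc1 Δ Δ x)) := by
  simp only [coassoc2, coassoc1, LinearMap.comp_apply, LinearMap.sub_apply, map_sub,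
    map_id_flipT, LinearEquiv.coe_coe]
  simp only [assoc_map_sub, map_sub_id, lTensor_flipT_eq, map_sub]

theorem co_jacobi (Δ : A →ₗ[K] A ⊗[K] A) (h : IsPreLieCo Δ) :
    IsLieCobracket (Δ - flipT K A ∘ₗ Δ) := by
  refine ⟨fun x => ?_, fun x => ?_⟩
  · simp only [LinearMap.comp_apply, LinearMap.sub_apply, map_sub, flipT_flipT]; abel
  · rw [coassoc2_comm]
    have h0 := h x
    have h1 := congrArg (cyc K A) h0
    have h2 := congrArg (cyc K A) h1
    simp only [map_sub, cyc_cyc_cyc] at h0 h1 h2 ⊢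
    linear_combination (norm := abel) -h0 - h1 - h2

theorem lie_of_preLie (m : A →ₗ[K] A →ₗ[K] A) (h : IsPreLie m) :
    IsLieBracket (m - m.flip) := by
  refine ⟨fun x => by simp, fun x y z => ?_⟩
  have h1 := h x y z
  have h2 := h y z x
  have h3 := h z x y
  simp only [LinearMap.sub_apply, LinearMap.flip_apply, map_sub]
  linear_combination (norm := abel) h1 + h2 + h3

theorem compat_iff (m : A →ₗ[K] A →ₗ[K] A) (Δ : A →ₗ[K] A ⊗[K] A) (h : BialgEq1 m Δ) :
    (∀ x y : A, (Δ - flipT K A ∘ₗ Δ) ((m - m.flip) x y)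
      = rTensor A ((m - m.flip) x) ((Δ - flipT K A ∘ₗ Δ) y)
        + lTensor A ((m - m.flip) x) ((Δ - flipT K A ∘ₗ Δ) y)
        - rTensor A ((m - m.flip) y) ((Δ - flipT K A ∘ₗ Δ) x)
        - lTensor A ((m - m.flip) y) ((Δ - flipT K A ∘ₗ Δ) x)) ↔ IsBalanced m Δ := by
  unfold IsBalanced
  refine forall_congr' fun x => forall_congr' fun y => ?_
  have h1 := h x y
  have h2 := congrArg (flipT K A) h1
  simp only [LinearMap.comp_apply, LinearMap.sub_apply, LinearMap.flip_apply, map_sub, map_add,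
    rTensor_sub, lTensor_sub, flipT_rTensor, flipT_lTensor] at h1 h2 ⊢
  constructor
  · intro h3
    linear_combination (norm := abel) h1 - h2 - h3
  · intro h3
    linear_combination (norm := abel) h1 - h2 - h3

end Helpers

section Theorems

variable {K A V H : Type*} [Field K] [AddCommGroup A] [Module K A]
  [AddCommGroup V] [Module K V] [AddCommGroup H] [Module K H]

theorem nijenhuis_lie_bialgebra_iff_balanced
    (m : A →ₗ[K] A →ₗ[K] A) (Δ : A →ₗ[K] A ⊗[K] A) (N S : A →ₗ[K] A)
    (hbialg : IsNijPreLieBialg m Δ N S) :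
    IsNijLieBialg (m - m.flip) (Δ - flipT K A ∘ₗ Δ) N S ↔ IsBalanced m Δ := by
  obtain ⟨hp, hN, hc, hS, hb, -, ⟨ha1, ha2⟩, hd1, hd2⟩ := hbialg
  rw [← compat_iff m Δ hb]
  constructor
  · exact fun h => h.1.2.2
  · intro h
    refine ⟨⟨lie_of_preLie m hp, co_jacobi Δ hc, h⟩, fun x y => ?_, fun x => ?_,
      fun x y => ?_, fun x => ?_⟩
    · have h1 := hN x y
      have h2 := hN y x
      simp only [LinearMap.sub_apply, LinearMap.flip_apply, map_sub]
      linear_combination (norm := abel) h1 - h2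
    · have h1 := hS x
      have h2 := congrArg (flipT K A) h1
      simp only [LinearMap.comp_apply, LinearMap.sub_apply, map_sub, map_add,
        flipT_rTensor, flipT_lTensor, flipT_map] at h1 h2 ⊢
      linear_combination (norm := abel) h1 - h2
    · have h1 := ha1 x y
      have h2 := ha2 y x
      simp only [LinearMap.sub_apply, LinearMap.flip_apply, map_sub]
      linear_combination (norm := abel) h1 - h2
    · have h1 := hd2 x
      have h2 := congrArg (flipT K A) (hd1 x)
      simp only [LinearMap.comp_apply, LinearMap.sub_apply, map_sub, map_add,
        flipT_rTensor, flipT_lTensor, flipT_map] at h1 h2 ⊢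
      linear_combination (norm := abel) h1 - h2

end Theorems
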